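/- arXiv:2208.08938 — 4 statements merged into one kernel-verified Lean document; each statement's English description precedes it below -/
import Mathlib

section
/- Let Σ ∈ ℝ^{p×p} be symmetric positive semidefinite with orthonormal eigenvectors u_1,…,u_p and eigenvalues λ_1 ≥ … ≥ λ_p, and suppose λ_k > λ_{k+1}. Let Π = Σ_{l=1}^k u_l u_l^T be its k-dimensional principal component matrix, and let J ⊆ [p] satisfy Π_{i,i} = 0 for every i ∉ J. Then for every l with 1 ≤ l ≤ k, the vector (u_l)_J ∈ ℝ^{|J|} obtained by restricting u_l to the coordinates in J is an eigenvector of the principal submatrix Σ_{J,J} with eigenvalue λ_l. -/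
open Matrix Finset

noncomputable section

/-- the projector onto the span of the first `k` columns of `U` -/
def pcProj {p : ℕ} (U : Matrix (Fin p) (Fin p) ℝ) (k : ℕ) : Matrix (Fin p) (Fin p) ℝ :=
  U * Matrix.diagonal (fun l : Fin p => if (l : ℕ) < k then (1 : ℝ) else 0) * Uᵀ

/-- principal submatrix with rows and columns indexed by J -/
def subJJ {p : ℕ} (A : Matrix (Fin p) (Fin p) ℝ) (J : Finset (Fin p)) :
    Matrix {i // i ∈ J} {i // i ∈ J} ℝ := A.submatrix Subtype.val Subtype.val

/-- A vanishing diagonal entry of the projector kills that coordinate of every leading column. -/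
theorem eq_zero_of_pcProj_diag_eq_zero {p k : ℕ} {U : Matrix (Fin p) (Fin p) ℝ} {i : Fin p}
    (h : pcProj U k i i = 0) {l : Fin p} (hl : (l : ℕ) < k) : U i l = 0 := by
  have hsum : ∑ m : Fin p, (if (m : ℕ) < k then U i m ^ 2 else 0) = 0 := by
    refine Eq.trans ?_ h
    rw [pcProj, Matrix.mul_apply]
    refine Finset.sum_congr rfl fun m _ => ?_
    rw [Matrix.mul_diagonal, Matrix.transpose_apply]
    split_ifs <;> ring
  have hnonneg : ∀ m ∈ (Finset.univ : Finset (Fin p)),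
      0 ≤ (if (m : ℕ) < k then U i m ^ 2 else 0) := by
    intro m _
    split_ifs <;> positivity
  have hterm := (Finset.sum_eq_zero_iff_of_nonneg hnonneg).1 hsum l (Finset.mem_univ l)
  rw [if_pos hl] at hterm
  exact pow_eq_zero_iff two_ne_zero |>.1 hterm

/-- Let `Σ = U (diagonal d) Uᵀ` be symmetric PSD with `U` orthogonal
(columns are orthonormal eigenvectors `u_1,…,u_p`) and eigenvalues
`d 0 ≥ d 1 ≥ … ≥ d (p-1) ≥ 0`, with spectral gap `d (k-1) > d k`.  Let
`Π = pcProj U k` be the k-dimensional principal component matrix and suppose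
`Π_{i,i} = 0` for all `i ∉ J`.  Then for every `l < k`, the restriction of the
eigenvector `u_l` to the coordinates in `J` is an eigenvector of the principal
submatrix `Σ_{J,J}` with eigenvalue `d l`. -/
theorem sub_eigenvectors {p k : ℕ} (hk0 : 0 < k) (hkp : k < p)
    (U : Matrix (Fin p) (Fin p) ℝ) (hU : U * Uᵀ = 1) (hU' : Uᵀ * U = 1)
    (d : Fin p → ℝ) (hd : Antitone d) (hd0 : ∀ l, 0 ≤ d l)
    (hgap : d ⟨k, hkp⟩ < d ⟨k - 1, lt_trans (by omega) hkp⟩)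
    (J : Finset (Fin p)) (hJ : ∀ i, i ∉ J → pcProj U k i i = 0) :
    ∀ l : Fin p, (l : ℕ) < k →
      (subJJ (U * Matrix.diagonal d * Uᵀ) J).mulVec (fun j => U j.val l) =
        d l • (fun j : {i // i ∈ J} => U j.val l) := by
  intro l hl
  have heig : U * Matrix.diagonal d * Uᵀ * U = U * Matrix.diagonal d := by
    rw [Matrix.mul_assoc, hU', Matrix.mul_one]
  funext j
  have hj := congrFun (congrFun heig j.val) l
  rw [Matrix.mul_diagonal, Matrix.mul_apply] at hj
  rw [Pi.smul_apply, smul_eq_mul, mul_comm, ← hj]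
  change ∑ i : {i // i ∈ J}, (U * Matrix.diagonal d * Uᵀ) j.val i.val * U i.val l = _
  rw [Finset.sum_coe_sort J fun i => (U * Matrix.diagonal d * Uᵀ) j.val i * U i l]
  refine Finset.sum_subset (Finset.subset_univ J) fun i _ hi => ?_
  rw [eq_zero_of_pcProj_diag_eq_zero (hJ i hi) hl, mul_zero]

end
end

section
/- Let U ∈ ℝ^{p×p} be orthogonal and Λ ∈ ℝ^{p×p} diagonal with nonnegative entries bounded by λ_1, and set Σ = UΛU^T. Let R be a random p×p matrix with E‖R − I_p‖_{1,∞}² ≤ C/p, and let D be a random symmetric p×p matrix, independent of R, with E[D] = 0 and integrable entries. Then ‖E[R U(Λ + D)U^T R^T] − Σ‖_{∞,∞} ≤ (C/p)·λ_1 + 2√(C/p)·λ_1. -/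
open Matrix Finset MeasureTheory ProbabilityTheory Real

noncomputable section

/-- entrywise sup norm ‖A‖_{∞,∞} -/
def ninf {m n : Type*} [Fintype m] [Fintype n] (A : Matrix m n ℝ) : ℝ :=
  ⨆ i, ⨆ j, |A i j|

/-- ‖A‖_{1,∞} : max over rows of the ℓ¹ norm of the row -/
def norm1inf {m n : Type*} [Fintype m] [Fintype n] (A : Matrix m n ℝ) : ℝ :=
  ⨆ i, ∑ j, |A i j|

instance matrixMeasurableSpace {m n : Type*} : MeasurableSpace (Matrix m n ℝ) :=
  MeasurableSpace.pi

theorem sum_abs_le_norm1inf {m n : Type*} [Fintype m] [Fintype n] (A : Matrix m n ℝ) (i : m) :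
    ∑ j, |A i j| ≤ norm1inf A :=
  le_ciSup (f := fun i => ∑ j, |A i j|) (Set.finite_range _).bddAbove i

theorem norm1inf_nonneg {m n : Type*} [Fintype m] [Fintype n] (A : Matrix m n ℝ) :
    0 ≤ norm1inf A :=
  Real.iSup_nonneg fun _ => Finset.sum_nonneg fun _ _ => abs_nonneg _

theorem abs_apply_le_norm1inf {m n : Type*} [Fintype m] [Fintype n] (A : Matrix m n ℝ)
    (i : m) (j : n) : |A i j| ≤ norm1inf A :=
  (Finset.single_le_sum (f := fun j => |A i j|) (fun _ _ => abs_nonneg _)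
    (Finset.mem_univ j)).trans (sum_abs_le_norm1inf A i)

theorem ninf_le {m n : Type*} [Fintype m] [Fintype n] {A : Matrix m n ℝ} {c : ℝ} (hc : 0 ≤ c)
    (h : ∀ i j, |A i j| ≤ c) : ninf A ≤ c :=
  Real.iSup_le (fun i => Real.iSup_le (h i) hc) hc

/-- Hölder's inequality for the entries of a matrix product. -/
theorem abs_mul_apply_le_norm1inf_mul {m n k : Type*} [Fintype m] [Fintype n]
    {A : Matrix m n ℝ} {B : Matrix n k ℝ} {c : ℝ} {j : k} (hc : 0 ≤ c) (hB : ∀ l, |B l j| ≤ c)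
    (i : m) : |(A * B) i j| ≤ norm1inf A * c := by
  rw [Matrix.mul_apply]
  calc |∑ l, A i l * B l j| ≤ ∑ l, |A i l * B l j| := Finset.abs_sum_le_sum_abs _ _
    _ ≤ ∑ l, |A i l| * c := Finset.sum_le_sum fun l _ => by
        rw [abs_mul]; exact mul_le_mul_of_nonneg_left (hB l) (abs_nonneg _)
    _ = (∑ l, |A i l|) * c := (Finset.sum_mul _ _ _).symm
    _ ≤ norm1inf A * c := mul_le_mul_of_nonneg_right (sum_abs_le_norm1inf A i) hc

/-- Entrywise bound for the perturbation of `S` under `S ↦ R S Rᵀ`. -/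
theorem abs_mul_mul_transpose_sub_apply_le {n : Type*} [Fintype n] [DecidableEq n]
    (R : Matrix n n ℝ) {S : Matrix n n ℝ} {c : ℝ} (hc : 0 ≤ c) (hS : ∀ i j, |S i j| ≤ c)
    (i j : n) :
    |(R * S * Rᵀ) i j - S i j| ≤ (norm1inf (R - 1) ^ 2 + 2 * norm1inf (R - 1)) * c := by
  set A := R - 1 with hA
  have hN := norm1inf_nonneg A
  have right_mul (a : n) : |(S * Aᵀ) a j| ≤ norm1inf A * c := by
    have h := abs_mul_apply_le_norm1inf_mul (A := A) (B := Sᵀ) (j := a) hc (fun l => hS a l) j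
    rwa [← Matrix.transpose_apply (A * Sᵀ), Matrix.transpose_mul, Matrix.transpose_transpose] at h
  have left_mul := abs_mul_apply_le_norm1inf_mul (A := A) (j := j) hc (fun l => hS l j) i
  have both_mul := abs_mul_apply_le_norm1inf_mul (A := A) (mul_nonneg hN hc) right_mul i
  have expand : R * S * Rᵀ - S = A * S + S * Aᵀ + A * (S * Aᵀ) := by
    rw [hA, Matrix.transpose_sub, Matrix.transpose_one]
    noncomm_ring
  rw [← Matrix.sub_apply, expand, Matrix.add_apply, Matrix.add_apply]
  calc _ ≤ _ := abs_add_three _ _ _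
    _ ≤ norm1inf A * c + norm1inf A * c + norm1inf A * (norm1inf A * c) := by
        gcongr
        exact right_mul i
    _ = _ := by ring

theorem abs_mul_diagonal_mul_transpose_apply_le {n : Type*} [Fintype n] [DecidableEq n]
    {U : Matrix n n ℝ} (hU : U * Uᵀ = 1) {d : n → ℝ} {c : ℝ} (hd0 : ∀ l, 0 ≤ d l)
    (hd1 : ∀ l, d l ≤ c) (i j : n) : |(U * Matrix.diagonal d * Uᵀ) i j| ≤ c := by
  have hc : 0 ≤ c := (hd0 i).trans (hd1 i)
  have row_norm (a : n) : ∑ l, U a l ^ 2 = 1 := by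
    have h := congrFun (congrFun hU a) a
    simpa [Matrix.mul_apply, ← sq] using h
  rw [Matrix.mul_apply]
  simp only [Matrix.mul_diagonal, Matrix.transpose_apply]
  calc |∑ l, U i l * d l * U j l| ≤ ∑ l, |U i l * d l * U j l| := Finset.abs_sum_le_sum_abs _ _
    _ ≤ ∑ l, c * ((U i l ^ 2 + U j l ^ 2) / 2) := Finset.sum_le_sum fun l _ => by
        have amgm : |U i l| * |U j l| ≤ (U i l ^ 2 + U j l ^ 2) / 2 := by
          nlinarith [sq_nonneg (|U i l| - |U j l|), sq_abs (U i l), sq_abs (U j l)]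
        rw [abs_mul, abs_mul, abs_of_nonneg (hd0 l), mul_right_comm, mul_comm]
        exact mul_le_mul (hd1 l) amgm (by positivity) hc
    _ = c := by
        rw [← Finset.mul_sum, ← Finset.sum_div, Finset.sum_add_distrib, row_norm, row_norm]
        ring

section RandomMatrix

variable {Ω : Type*} [MeasurableSpace Ω] {μ : Measure Ω} {n : Type*}

theorem measurable_matrix_apply {m n : Type*} (i : m) (j : n) :
    Measurable fun M : Matrix m n ℝ => M i j :=
  (measurable_pi_apply j).comp (measurable_pi_apply i)

theorem memLp_two_norm1inf [Fintype n] {A : Ω → Matrix n n ℝ}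
    (hA : Integrable (fun ω => norm1inf (A ω) ^ 2) μ) :
    MemLp (fun ω => norm1inf (A ω)) 2 μ := by
  have measurable_norm : AEStronglyMeasurable (fun ω => norm1inf (A ω)) μ := by
    have h := Real.continuous_sqrt.comp_aestronglyMeasurable hA.aestronglyMeasurable
    simpa only [Function.comp_def, Real.sqrt_sq (norm1inf_nonneg _)] using h
  exact (memLp_two_iff_integrable_sq measurable_norm).2 hA

theorem integral_le_sqrt_integral_sq [IsProbabilityMeasure μ] {X : Ω → ℝ} (hX : MemLp X 2 μ) :
    ∫ ω, X ω ∂μ ≤ √(∫ ω, X ω ^ 2 ∂μ) := by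
  have h := variance_nonneg X μ
  rw [variance_eq_sub hX] at h
  exact Real.le_sqrt_of_sq_le (sub_nonneg.1 h)

variable [Fintype n]

theorem memLp_two_apply [DecidableEq n] [IsProbabilityMeasure μ] {R : Ω → Matrix n n ℝ}
    (hRm : Measurable R) (hR : Integrable (fun ω => norm1inf (R ω - 1) ^ 2) μ) (i j : n) :
    MemLp (fun ω => R ω i j) 2 μ := by
  have hm : Measurable fun ω => R ω i j := (measurable_matrix_apply i j).comp hRm
  have h : MemLp (fun ω => R ω i j - (1 : Matrix n n ℝ) i j) 2 μ :=
    (memLp_two_norm1inf hR).mono (hm.sub_const _).aestronglyMeasurable <|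
      .of_forall fun ω => by
        rw [Real.norm_eq_abs, Real.norm_of_nonneg (norm1inf_nonneg _)]
        exact abs_apply_le_norm1inf (R ω - 1) i j
  exact (h.add (memLp_const ((1 : Matrix n n ℝ) i j))).ae_eq (.of_forall fun ω => by simp)

/-- The entries of `A M B` have mean zero when those of `M` do. -/
theorem integral_mul_mul_apply_eq_zero {M : Ω → Matrix n n ℝ} (A B : Matrix n n ℝ)
    (hM : ∀ i j, Integrable (fun ω => M ω i j) μ) (hM0 : ∀ i j, ∫ ω, M ω i j ∂μ = 0) (i j : n) :
    Integrable (fun ω => (A * M ω * B) i j) μ ∧ ∫ ω, (A * M ω * B) i j ∂μ = 0 := by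
  simp only [Matrix.mul_apply, Finset.sum_mul]
  have term_int (l k : n) : Integrable (fun ω => A i k * M ω k l * B l j) μ :=
    ((hM k l).const_mul _).mul_const _
  refine ⟨integrable_finsetSum _ fun l _ => integrable_finsetSum _ fun k _ => term_int l k, ?_⟩
  rw [integral_finsetSum _ fun l _ => integrable_finsetSum _ fun k _ => term_int l k]
  refine Finset.sum_eq_zero fun l _ => ?_
  rw [integral_finsetSum _ fun k _ => term_int l k]
  refine Finset.sum_eq_zero fun k _ => ?_
  rw [integral_mul_const, integral_const_mul, hM0]
  simp

/-- The entries of `R M Rᵀ` have mean zero when `M` is centred and independent of `R`. -/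
theorem IndepFun.integral_mul_mul_transpose_apply_eq_zero {R M : Ω → Matrix n n ℝ}
    (hRM : IndepFun R M μ) (hR : ∀ i j, MemLp (fun ω => R ω i j) 2 μ)
    (hM : ∀ i j, Integrable (fun ω => M ω i j) μ) (hM0 : ∀ i j, ∫ ω, M ω i j ∂μ = 0) (i j : n) :
    Integrable (fun ω => (R ω * M ω * (R ω)ᵀ) i j) μ ∧
      ∫ ω, (R ω * M ω * (R ω)ᵀ) i j ∂μ = 0 := by
  simp only [Matrix.mul_apply, Finset.sum_mul, Matrix.transpose_apply, mul_right_comm]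
  have indep (l k : n) : IndepFun (fun ω => R ω i k * R ω j l) (fun ω => M ω k l) μ :=
    hRM.comp (φ := fun A : Matrix n n ℝ => A i k * A j l) (ψ := fun A : Matrix n n ℝ => A k l)
      ((measurable_matrix_apply i k).mul (measurable_matrix_apply j l))
      (measurable_matrix_apply k l)
  have prod_int (l k : n) : Integrable (fun ω => R ω i k * R ω j l) μ :=
    (hR i k).integrable_mul (hR j l)
  have term_int (l k : n) : Integrable (fun ω => R ω i k * R ω j l * M ω k l) μ :=
    (indep l k).integrable_mul (prod_int l k) (hM k l)
  refine ⟨integrable_finsetSum _ fun l _ => integrable_finsetSum _ fun k _ => term_int l k, ?_⟩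
  rw [integral_finsetSum _ fun l _ => integrable_finsetSum _ fun k _ => term_int l k]
  refine Finset.sum_eq_zero fun l _ => ?_
  rw [integral_finsetSum _ fun k _ => term_int l k]
  refine Finset.sum_eq_zero fun k _ => ?_
  rw [(indep l k).integral_fun_mul_eq_mul_integral (prod_int l k).aestronglyMeasurable
    (hM k l).aestronglyMeasurable, hM0, mul_zero]

theorem measurable_mul_mul (A B : Matrix n n ℝ) :
    Measurable fun M : Matrix n n ℝ => A * M * B := by
  refine measurable_pi_lambda _ fun i => measurable_pi_lambda _ fun j => ?_
  simp only [Matrix.mul_apply]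
  exact Finset.measurable_sum _ fun l _ => (Finset.measurable_sum _ fun k _ =>
    (measurable_matrix_apply k l).const_mul _).mul_const _

end RandomMatrix

/-- Bias of the perturbed covariance.  With `Σ = U Λ Uᵀ`,
`U` orthogonal and `Λ = diagonal d`, `0 ≤ d ≤ λ₁`; `R` a random matrix with
`E‖R − I‖²_{1,∞} ≤ C/p`; and `D` a random symmetric matrix independent of `R`
with mean `0` and integrable entries, we have
`‖E[R U (Λ + D) Uᵀ Rᵀ] − Σ‖_{∞,∞} ≤ (C/p) λ₁ + 2 √(C/p) λ₁`. -/
theorem bias_bound {Ω : Type*} [MeasurableSpace Ω] (μ : Measure Ω)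
    [IsProbabilityMeasure μ] {p : ℕ} (hp : 0 < p)
    (U : Matrix (Fin p) (Fin p) ℝ) (hU : U * Uᵀ = 1) (hU' : Uᵀ * U = 1)
    (d : Fin p → ℝ) (lam1 : ℝ) (hd0 : ∀ l, 0 ≤ d l) (hd1 : ∀ l, d l ≤ lam1)
    (R D : Ω → Matrix (Fin p) (Fin p) ℝ)
    (hRm : Measurable R) (hDm : Measurable D)
    (C : ℝ)
    (hR2int : Integrable (fun ω => (norm1inf (R ω - 1)) ^ 2) μ)
    (hR2 : ∫ ω, (norm1inf (R ω - 1)) ^ 2 ∂μ ≤ C / p)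
    (hDsym : ∀ ω, (D ω).IsSymm)
    (hindep : IndepFun R D μ)
    (hDint : ∀ i j, Integrable (fun ω => D ω i j) μ)
    (hD0 : ∀ i j, ∫ ω, D ω i j ∂μ = 0)
    (hprodint : ∀ i j, Integrable
      (fun ω => (R ω * (U * (Matrix.diagonal d + D ω) * Uᵀ) * (R ω)ᵀ) i j) μ) :
    ninf ((Matrix.of fun i j =>
        ∫ ω, (R ω * (U * (Matrix.diagonal d + D ω) * Uᵀ) * (R ω)ᵀ) i j ∂μ) -
      U * Matrix.diagonal d * Uᵀ) ≤
      (C / p) * lam1 + 2 * Real.sqrt (C / p) * lam1 := by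
  set S := U * Matrix.diagonal d * Uᵀ with hS
  set N := fun ω => norm1inf (R ω - 1)
  have hlam : 0 ≤ lam1 := (hd0 ⟨0, hp⟩).trans (hd1 _)
  have hSle (i j) : |S i j| ≤ lam1 := abs_mul_diagonal_mul_transpose_apply_le hU hd0 hd1 i j
  have hN : MemLp N 2 μ := memLp_two_norm1inf hR2int
  have hNint : Integrable N μ := hN.integrable one_le_two
  have hmean : ∫ ω, N ω ∂μ ≤ √(C / p) :=
    (integral_le_sqrt_integral_sq hN).trans (Real.sqrt_le_sqrt hR2)
  have hCp : 0 ≤ C / p := (integral_nonneg fun ω => sq_nonneg (N ω)).trans hR2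
  refine ninf_le (by positivity) fun i j => ?_
  rw [Matrix.sub_apply, Matrix.of_apply]
  obtain ⟨hnoise_int, hnoise⟩ := IndepFun.integral_mul_mul_transpose_apply_eq_zero
    (hindep.comp measurable_id (measurable_mul_mul U Uᵀ)) (memLp_two_apply hRm hR2int)
    (fun a b => (integral_mul_mul_apply_eq_zero U Uᵀ hDint hD0 a b).1)
    (fun a b => (integral_mul_mul_apply_eq_zero U Uᵀ hDint hD0 a b).2) i j
  simp only [Function.comp_apply, id_eq] at hnoise_int hnoise
  have split (ω) : (R ω * (U * (Matrix.diagonal d + D ω) * Uᵀ) * (R ω)ᵀ) i j =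
      (R ω * S * (R ω)ᵀ) i j + (R ω * (U * D ω * Uᵀ) * (R ω)ᵀ) i j := by
    rw [hS, ← Matrix.add_apply]
    simp only [Matrix.mul_add, Matrix.add_mul]
  have hsignal_int : Integrable (fun ω => (R ω * S * (R ω)ᵀ) i j) μ := by
    refine ((hprodint i j).sub hnoise_int).congr (.of_forall fun ω => ?_)
    simp only [Pi.sub_apply, split, add_sub_cancel_right]
  have hdrop : ∫ ω, (R ω * (U * (Matrix.diagonal d + D ω) * Uᵀ) * (R ω)ᵀ) i j ∂μ - S i j =
      ∫ ω, ((R ω * S * (R ω)ᵀ) i j - S i j) ∂μ := by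
    simp only [split]
    rw [integral_add hsignal_int hnoise_int, hnoise, add_zero,
      integral_sub hsignal_int (integrable_const _), integral_const, probReal_univ, one_smul]
  have hbound_int : Integrable (fun ω => (N ω ^ 2 + 2 * N ω) * lam1) μ :=
    (hR2int.add (hNint.const_mul 2)).mul_const lam1
  rw [hdrop]
  calc |∫ ω, ((R ω * S * (R ω)ᵀ) i j - S i j) ∂μ|
      ≤ ∫ ω, (N ω ^ 2 + 2 * N ω) * lam1 ∂μ :=
        norm_integral_le_of_norm_le (f := fun ω => (R ω * S * (R ω)ᵀ) i j - S i j) hbound_int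
          (.of_forall fun ω => abs_mul_mul_transpose_sub_apply_le (R ω) hlam hSle i j)
    _ = (∫ ω, N ω ^ 2 ∂μ + 2 * ∫ ω, N ω ∂μ) * lam1 := by
        rw [integral_mul_const, integral_add hR2int (hNint.const_mul 2), integral_const_mul]
    _ ≤ (C / p + 2 * √(C / p)) * lam1 := by gcongr
    _ = _ := by ring

end
end

section
/- Let p, k be positive integers, J ⊆ [p] with |J| > k, S ∈ ℝ^{p×p} symmetric, and ρ > 0. The map H ↦ H_{J,J} is a bijection from {H ∈ 𝓕^k : H_{i,j} = 0 whenever i ∉ J or j ∉ J} onto 𝓕_J^k := {M ∈ ℝ^{|J|×|J|} : M symmetric, 0 ⪯ M ⪯ I_{|J|}, Trace(M) = k}, and for every such H one has ⟨S, H⟩ − ρ‖H‖_{1,1} = ⟨S_{J,J}, H_{J,J}⟩ − ρ‖H_{J,J}‖_{1,1}. Consequently, sup over the constrained p×p problem equals sup over the |J|×|J| problem, and H is a maximizer of the former if and only if H_{J,J} is a maximizer of the latter. -/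
open Matrix Finset

noncomputable section

/-- ‖A‖_{1,1} -/
def norm11 {m n : Type*} [Fintype m] [Fintype n] (A : Matrix m n ℝ) : ℝ :=
  ∑ i, ∑ j, |A i j|

/-- trace inner product ⟨A,B⟩ = Trace(AᵀB) -/
def minner {n : Type*} [Fintype n] (A B : Matrix n n ℝ) : ℝ := (Aᵀ * B).trace

/-- the Fantope 𝓕^k: symmetric matrices with 0 ⪯ M ⪯ I and trace k -/
def Fantope (n : Type*) [Fintype n] [DecidableEq n] (k : ℕ) : Set (Matrix n n ℝ) :=
  {M | M.PosSemidef ∧ (1 - M).PosSemidef ∧ M.trace = (k : ℝ)}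

/-- Conjugation by a matrix with orthonormal columns maps Fantopes into Fantopes. -/
theorem Fantope.mul_mul_conjTranspose_mem {m n : Type*} [Fintype m] [Fintype n] [DecidableEq m]
    [DecidableEq n] {k : ℕ} {M : Matrix n n ℝ} (hM : M ∈ Fantope n k) {V : Matrix m n ℝ}
    (hV : Vᴴ * V = 1) : V * M * Vᴴ ∈ Fantope m k := by
  obtain ⟨h0, h1, ht⟩ := hM
  refine ⟨h0.mul_mul_conjTranspose_same V, ?_, ?_⟩
  · have hP : (1 - V * Vᴴ)ᴴ * (1 - V * Vᴴ) = 1 - V * Vᴴ := by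
      have hVV : V * Vᴴ * (V * Vᴴ) = V * Vᴴ := by
        rw [Matrix.mul_assoc, ← Matrix.mul_assoc Vᴴ, hV, Matrix.one_mul]
      rw [Matrix.conjTranspose_sub, Matrix.conjTranspose_mul, Matrix.conjTranspose_conjTranspose,
        Matrix.conjTranspose_one, Matrix.sub_mul, Matrix.mul_sub, Matrix.mul_sub, hVV]
      simp
    have hsum : 1 - V * M * Vᴴ = V * (1 - M) * Vᴴ + (1 - V * Vᴴ)ᴴ * (1 - V * Vᴴ) := by
      rw [hP]
      simp [Matrix.sub_mul, Matrix.mul_sub]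
    rw [hsum]
    exact (h1.mul_mul_conjTranspose_same V).add (posSemidef_conjTranspose_mul_self _)
  · rw [Matrix.trace_mul_comm, ← Matrix.mul_assoc, hV, Matrix.one_mul, ht]

theorem sum_eq_sum_coe_of_forall_notMem_eq_zero {ι : Type*} [Fintype ι] (J : Finset ι)
    {f : ι → ℝ} (hf : ∀ i ∉ J, f i = 0) : ∑ i, f i = ∑ i : {i // i ∈ J}, f i := by
  rw [Finset.sum_coe_sort J f]
  exact (Finset.sum_subset J.subset_univ fun i _ hi => hf i hi).symm

section SupportedMatrices

variable {p k : ℕ} {J : Finset (Fin p)} {H : Matrix (Fin p) (Fin p) ℝ}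

theorem norm11_subJJ (hH : ∀ i j, i ∉ J ∨ j ∉ J → H i j = 0) :
    norm11 (subJJ H J) = norm11 H := by
  unfold norm11
  rw [sum_eq_sum_coe_of_forall_notMem_eq_zero J fun i hi =>
    Finset.sum_eq_zero fun j _ => by simp [hH i j (.inl hi)]]
  refine Finset.sum_congr rfl fun i _ => ?_
  rw [sum_eq_sum_coe_of_forall_notMem_eq_zero J fun j hj => by simp [hH i j (.inr hj)]]
  rfl

theorem minner_subJJ (S : Matrix (Fin p) (Fin p) ℝ)
    (hH : ∀ i j, i ∉ J ∨ j ∉ J → H i j = 0) :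
    minner (subJJ S J) (subJJ H J) = minner S H := by
  simp only [minner, Matrix.trace, Matrix.diag_apply, Matrix.mul_apply, Matrix.transpose_apply]
  rw [sum_eq_sum_coe_of_forall_notMem_eq_zero J fun i hi =>
    Finset.sum_eq_zero fun j _ => by simp [hH j i (.inr hi)]]
  refine Finset.sum_congr rfl fun i _ => ?_
  rw [sum_eq_sum_coe_of_forall_notMem_eq_zero J fun j hj => by simp [hH j i (.inl hj)]]
  rfl

theorem subJJ_mem_fantope (hF : H ∈ Fantope (Fin p) k)
    (hH : ∀ i j, i ∉ J ∨ j ∉ J → H i j = 0) : subJJ H J ∈ Fantope {i // i ∈ J} k := by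
  obtain ⟨h0, h1, ht⟩ := hF
  refine ⟨h0.submatrix _, ?_, ?_⟩
  · have h := h1.submatrix (Subtype.val : {i // i ∈ J} → Fin p)
    rwa [Matrix.submatrix_sub, Pi.sub_apply, Pi.sub_apply,
      Matrix.submatrix_one _ Subtype.val_injective] at h
  · simp only [← ht, Matrix.trace, Matrix.diag_apply]
    rw [sum_eq_sum_coe_of_forall_notMem_eq_zero J fun i hi => hH i i (.inl hi)]
    rfl

theorem exists_subJJ_eq {M : Matrix {i // i ∈ J} {i // i ∈ J} ℝ}
    (hM : M ∈ Fantope {i // i ∈ J} k) :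
    ∃ H ∈ Fantope (Fin p) k, (∀ i j, i ∉ J ∨ j ∉ J → H i j = 0) ∧ subJJ H J = M := by
  set V : Matrix (Fin p) {i // i ∈ J} ℝ := (1 : Matrix (Fin p) (Fin p) ℝ).submatrix id Subtype.val
    with hVdef
  have hVJ : V.submatrix (Subtype.val : {i // i ∈ J} → Fin p) id = 1 := by
    simp [hVdef, Matrix.submatrix_one _ Subtype.val_injective]
  have hV : Vᴴ * V = 1 := by
    rw [hVdef, Matrix.conjTranspose_submatrix, Matrix.conjTranspose_one,
      ← Matrix.submatrix_mul _ _ _ _ _ Function.bijective_id, Matrix.one_mul,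
      Matrix.submatrix_one _ Subtype.val_injective]
  have hV0 : ∀ i ∉ J, ∀ j, V i j = 0 := fun i hi j =>
    Matrix.one_apply_ne fun h : i = j => hi (h ▸ j.2)
  refine ⟨V * M * Vᴴ, Fantope.mul_mul_conjTranspose_mem hM hV, ?_, ?_⟩
  · rintro i j (hi | hj)
    · simp [Matrix.mul_apply, hV0 i hi]
    · simp [Matrix.mul_apply, hV0 j hj]
  · rw [subJJ, Matrix.submatrix_mul _ _ _ id _ Function.bijective_id,
      Matrix.submatrix_mul _ _ _ id _ Function.bijective_id, ← Matrix.conjTranspose_submatrix, hVJ]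
    simp

theorem bijOn_subJJ (J : Finset (Fin p)) (k : ℕ) :
    Set.BijOn (fun H => subJJ H J)
      {H | H ∈ Fantope (Fin p) k ∧ ∀ i j, i ∉ J ∨ j ∉ J → H i j = 0}
      (Fantope {i // i ∈ J} k) := by
  refine ⟨fun H hH => subJJ_mem_fantope hH.1 hH.2, fun H hH H' hH' h => ?_, fun M hM => ?_⟩
  · ext i j
    by_cases hij : i ∈ J ∧ j ∈ J
    · exact congrFun (congrFun h ⟨i, hij.1⟩) ⟨j, hij.2⟩
    · rw [not_and_or] at hij
      rw [hH.2 i j hij, hH'.2 i j hij]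
  · obtain ⟨H, hF, hH, rfl⟩ := exists_subJJ_eq hM
    exact ⟨H, ⟨hF, hH⟩, rfl⟩

end SupportedMatrices

/-- For `J ⊆ [p]` with `|J| > k`, `S ∈ ℝ^{p×p}` symmetric and
`ρ > 0`: the map `H ↦ H_{J,J}` is a bijection from
`{H ∈ 𝓕^k : H_{i,j} = 0 whenever i ∉ J or j ∉ J}` onto the `|J|`-dimensional
Fantope `𝓕_J^k`; it preserves the penalised objective
`⟨S,H⟩ − ρ‖H‖_{1,1} = ⟨S_{J,J},H_{J,J}⟩ − ρ‖H_{J,J}‖_{1,1}`; consequently, the two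
suprema agree and `H` maximises the constrained p×p problem iff `H_{J,J}`
maximises the `|J|×|J|` problem. -/
theorem constrained_problem_reduction {p k : ℕ} (hk0 : 0 < k)
    (J : Finset (Fin p)) (hJk : k < J.card)
    (S : Matrix (Fin p) (Fin p) ℝ) (hS : S.IsSymm) (ρ : ℝ) (hρ : 0 < ρ) :
    Set.BijOn (fun H => subJJ H J)
        {H | H ∈ Fantope (Fin p) k ∧ ∀ i j, i ∉ J ∨ j ∉ J → H i j = 0}
        (Fantope {i // i ∈ J} k) ∧
    (∀ H ∈ {H | H ∈ Fantope (Fin p) k ∧ ∀ i j, i ∉ J ∨ j ∉ J → H i j = 0},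
      minner S H - ρ * norm11 H =
        minner (subJJ S J) (subJJ H J) - ρ * norm11 (subJJ H J)) ∧
    sSup ((fun H => minner S H - ρ * norm11 H) ''
        {H | H ∈ Fantope (Fin p) k ∧ ∀ i j, i ∉ J ∨ j ∉ J → H i j = 0}) =
      sSup ((fun M => minner (subJJ S J) M - ρ * norm11 M) '' Fantope {i // i ∈ J} k) ∧
    (∀ H ∈ {H | H ∈ Fantope (Fin p) k ∧ ∀ i j, i ∉ J ∨ j ∉ J → H i j = 0},
      ((∀ H' ∈ {H' | H' ∈ Fantope (Fin p) k ∧ ∀ i j, i ∉ J ∨ j ∉ J → H' i j = 0},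
          minner S H' - ρ * norm11 H' ≤ minner S H - ρ * norm11 H) ↔
        (∀ M ∈ Fantope {i // i ∈ J} k,
          minner (subJJ S J) M - ρ * norm11 M ≤
            minner (subJJ S J) (subJJ H J) - ρ * norm11 (subJJ H J)))) := by
  have hbij := bijOn_subJJ J k
  have hobj : ∀ H ∈ {H | H ∈ Fantope (Fin p) k ∧ ∀ i j, i ∉ J ∨ j ∉ J → H i j = 0},
      minner S H - ρ * norm11 H =
        minner (subJJ S J) (subJJ H J) - ρ * norm11 (subJJ H J) := fun H hH => by
    rw [minner_subJJ S hH.2, norm11_subJJ hH.2]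
  refine ⟨hbij, hobj, ?_, fun H hH => ?_⟩
  · rw [← hbij.image_eq, Set.image_image, Set.image_congr hobj]
  · rw [← hbij.image_eq, Set.forall_mem_image, ← hobj H hH]
    exact forall₂_congr fun H' hH' => by rw [hobj H' hH']

end
end

section
/- Let Q ∈ ℝ^{d×d} be orthogonal and P ∈ ℝ^{d×d} symmetric positive semidefinite with largest eigenvalue λ_1(P). Then ‖Q P Q^T − P‖_{∞,∞} ≤ 2 λ_1(P) · ‖Q − I_d‖_F. -/
open Matrix Finset

noncomputable section

/-- Frobenius norm -/
def frob {m n : Type*} [Fintype m] [Fintype n] (A : Matrix m n ℝ) : ℝ :=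
  Real.sqrt (∑ i, ∑ j, (A i j) ^ 2)

/-- Orthogonal matrices preserve the sum of squared coordinates. -/
lemma sum_sq_mulVec_of_transpose_mul_self {n : Type*} [Fintype n] [DecidableEq n]
    {U : Matrix n n ℝ} (hU : Uᵀ * U = 1) (x : n → ℝ) :
    ∑ i, (U *ᵥ x) i ^ 2 = ∑ i, x i ^ 2 := by
  have h : (U *ᵥ x) ⬝ᵥ (U *ᵥ x) = x ⬝ᵥ x := by
    rw [dotProduct_mulVec, ← mulVec_transpose, mulVec_mulVec, hU, one_mulVec]
  simpa only [dotProduct, ← sq] using h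

/-- A symmetric matrix whose eigenvalues are bounded by `c` in absolute value defines a bilinear
form bounded by `c`. -/
lemma Matrix.IsHermitian.abs_dotProduct_mulVec_le {n : Type*} [Fintype n] [DecidableEq n]
    {P : Matrix n n ℝ} (hP : P.IsHermitian) {c : ℝ} (hc : ∀ i, |hP.eigenvalues i| ≤ c)
    (x y : n → ℝ) :
    |x ⬝ᵥ P *ᵥ y| ≤ c * (√(∑ i, x i ^ 2) * √(∑ i, y i ^ 2)) := by
  let U : Matrix n n ℝ := (hP.eigenvectorUnitary : Matrix n n ℝ)
  have hU : Uᵀᵀ * Uᵀ = 1 := by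
    have := Unitary.coe_mul_star_self hP.eigenvectorUnitary
    rwa [Unitary.coe_star, star_eq_conjTranspose, conjTranspose_eq_transpose_of_trivial] at this
  have hspec : P = U * diagonal hP.eigenvalues * Uᵀ := by
    have := hP.spectral_theorem
    rw [Unitary.conjStarAlgAut_apply, star_eq_conjTranspose,
      conjTranspose_eq_transpose_of_trivial] at this
    exact this
  have hform : x ⬝ᵥ P *ᵥ y = ∑ k, (Uᵀ *ᵥ x) k * (hP.eigenvalues k * (Uᵀ *ᵥ y) k) := by
    conv_lhs => rw [hspec]
    rw [← mulVec_mulVec, ← mulVec_mulVec, dotProduct_mulVec, ← mulVec_transpose]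
    simp only [dotProduct, mulVec_diagonal]
  rcases isEmpty_or_nonempty n with hn | ⟨⟨k₀⟩⟩
  · simp
  have hc0 : 0 ≤ c := (abs_nonneg _).trans (hc k₀)
  calc |x ⬝ᵥ P *ᵥ y|
      ≤ ∑ k, |(Uᵀ *ᵥ x) k * (hP.eigenvalues k * (Uᵀ *ᵥ y) k)| := by
        rw [hform]; exact abs_sum_le_sum_abs _ _
    _ ≤ ∑ k, c * (|(Uᵀ *ᵥ x) k| * |(Uᵀ *ᵥ y) k|) := by
        refine sum_le_sum fun k _ => ?_
        rw [abs_mul, abs_mul, mul_left_comm]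
        gcongr
        exact hc k
    _ = c * ∑ k, |(Uᵀ *ᵥ x) k| * |(Uᵀ *ᵥ y) k| := by rw [mul_sum]
    _ ≤ c * (√(∑ k, |(Uᵀ *ᵥ x) k| ^ 2) * √(∑ k, |(Uᵀ *ᵥ y) k| ^ 2)) := by
        gcongr
        exact Real.sum_mul_le_sqrt_mul_sqrt _ _ _
    _ = c * (√(∑ i, x i ^ 2) * √(∑ i, y i ^ 2)) := by
        simp only [sq_abs, sum_sq_mulVec_of_transpose_mul_self hU]

/-- The Euclidean norm of a row is at most the Frobenius norm. -/
lemma sqrt_sum_sq_row_le_frob {m n : Type*} [Fintype m] [Fintype n] (A : Matrix m n ℝ) (i : m) :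
    √(∑ j, A i j ^ 2) ≤ frob A :=
  Real.sqrt_le_sqrt <| single_le_sum (f := fun i => ∑ j, A i j ^ 2)
    (fun _ _ => sum_nonneg fun _ _ => sq_nonneg _) (mem_univ i)

/-- For `Q ∈ ℝ^{d×d}` orthogonal and `P ∈ ℝ^{d×d}` symmetric positive
semidefinite with largest eigenvalue `λ₁(P)`,
`‖Q P Qᵀ − P‖_{∞,∞} ≤ 2 λ₁(P) ‖Q − I‖_F`. -/
theorem ninf_conj_sub_le_frob {d : ℕ} (Q P : Matrix (Fin d) (Fin d) ℝ)
    (hQ : Q * Qᵀ = 1) (hQ' : Qᵀ * Q = 1) (hP : P.PosSemidef) :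
    ninf (Q * P * Qᵀ - P) ≤ 2 * (⨆ i, hP.1.eigenvalues i) * frob (Q - 1) := by
  have hc0 : 0 ≤ ⨆ i, hP.1.eigenvalues i := Real.iSup_nonneg hP.eigenvalues_nonneg
  have hc : ∀ i, |hP.1.eigenvalues i| ≤ ⨆ i, hP.1.eigenvalues i := fun i => by
    rw [abs_of_nonneg (hP.eigenvalues_nonneg i)]
    exact le_ciSup (Set.finite_range _).bddAbove i
  have hF : 0 ≤ frob (Q - 1) := Real.sqrt_nonneg _
  refine Real.iSup_le (fun i => Real.iSup_le (fun j => ?_) (by positivity)) (by positivity)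
  have hrow : √(∑ k, Q j k ^ 2) = 1 := by
    have h : (Q * Qᵀ) j j = 1 := by rw [hQ, one_apply_eq]
    rw [mul_apply] at h
    simp only [transpose_apply, ← sq] at h
    rw [h, Real.sqrt_one]
  have hone : √(∑ k, (1 : Matrix (Fin d) (Fin d) ℝ) i k ^ 2) = 1 := by
    simp [one_apply]
  have hentry (A B : Matrix (Fin d) (Fin d) ℝ) : (A * P * Bᵀ) i j = A i ⬝ᵥ P *ᵥ B j := by
    rw [Matrix.mul_assoc]; rfl
  have hsplit : Q * P * Qᵀ - P = (Q - 1) * P * Qᵀ + 1 * P * (Q - 1)ᵀ := by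
    rw [transpose_sub, transpose_one]; noncomm_ring
  rw [hsplit, Matrix.add_apply, hentry, hentry]
  have h₁ := hP.1.abs_dotProduct_mulVec_le hc ((Q - 1) i) (Q j)
  have h₂ := hP.1.abs_dotProduct_mulVec_le hc ((1 : Matrix (Fin d) (Fin d) ℝ) i) ((Q - 1) j)
  rw [hrow, mul_one] at h₁
  rw [hone, one_mul] at h₂
  have h₃ := mul_le_mul_of_nonneg_left (sqrt_sum_sq_row_le_frob (Q - 1) i) hc0
  have h₄ := mul_le_mul_of_nonneg_left (sqrt_sum_sq_row_le_frob (Q - 1) j) hc0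
  refine (abs_add_le _ _).trans ?_
  linarith

end
end
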